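/- Let T be a tree with p(T) ≥ 4 and m(T, λ) = p(T) - 2 for a real eigenvalue λ. Let w be a major vertex such that T - w has components T_1, ..., T_s with m(T - w, λ) = p(T) - 1. If some component T_k satisfies m(T_k, λ) = p(T_k) - 2, then every other component T_j (j ≠ k) satisfies m(T_j, λ) = p(T_j) - 1. -/

import Mathlib

open scoped Classical

/-- Multiplicity of `lam` as an eigenvalue of a real symmetric matrix:
dimension of the kernel of `A - lam • 1`. -/
noncomputable def matMult {V : Type*} [Fintype V] [DecidableEq V]
    (A : Matrix V V ℝ) (lam : ℝ) : ℕ :=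
  Module.finrank ℝ (LinearMap.ker (Matrix.toLin' (A - lam • (1 : Matrix V V ℝ))))

/-- Adjacency matrix of a simple graph over ℝ. -/
noncomputable def adjM {V : Type*} [Fintype V] (G : SimpleGraph V) : Matrix V V ℝ :=
  fun i j => if G.Adj i j then 1 else 0

/-- Multiplicity of `lam` as an eigenvalue of the adjacency matrix of `G`. -/
noncomputable def gMult {V : Type*} [Fintype V] (G : SimpleGraph V) (lam : ℝ) : ℕ :=
  matMult (adjM G) lam

/-- Multiplicity of `lam` as an eigenvalue of the induced subgraph of `G` on `s`. -/
noncomputable def sMult {V : Type*} [Fintype V] (G : SimpleGraph V) (s : Set V) (lam : ℝ) : ℕ :=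
  gMult (G.induce s) lam

/-- Degree of a vertex, via the cardinality of its neighbor set. -/
noncomputable def deg {V : Type*} (G : SimpleGraph V) (v : V) : ℕ :=
  (G.neighborSet v).ncard

/-- Number of pendant (degree-1) vertices. -/
noncomputable def pendCount {V : Type*} (G : SimpleGraph V) : ℕ :=
  {v : V | deg G v = 1}.ncard

/-- Number of pendant vertices, with the paper's convention that a
single-vertex graph has `p = 2`. -/
noncomputable def pendCount' {V : Type*} (G : SimpleGraph V) : ℕ :=
  if Nat.card V ≤ 1 then 2 else pendCount G

/-- A graph is (isomorphic to) a path graph. -/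
def IsPathGraph {W : Type*} (H : SimpleGraph W) : Prop :=
  ∃ n : ℕ, Nonempty (H ≃g SimpleGraph.pathGraph n)

/-- The vertex sets (as subsets of `V`) of the connected components of `G - w`. -/
def compSupp {V : Type*} (G : SimpleGraph V) (w : V)
    (c : (G.induce {u | u ≠ w}).ConnectedComponent) : Set V :=
  Subtype.val '' c.supp

/-- The eigenspace of the adjacency matrix of `G` for `lam`. -/
noncomputable def adjEigenspace {V : Type*} [Fintype V] (G : SimpleGraph V) (lam : ℝ) :
    Submodule ℝ (V → ℝ) :=
  LinearMap.ker (Matrix.toLin' (adjM G - lam • (1 : Matrix V V ℝ)))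

theorem sMult_eq_gMult_induce {V : Type*} [Fintype V] (G : SimpleGraph V) (s : Set V) [Fintype s]
    (lam : ℝ) : sMult G s lam = gMult (G.induce s) lam := by
  unfold sMult
  congr!

theorem mem_adjEigenspace {V : Type*} [Fintype V] {G : SimpleGraph V} {lam : ℝ} {x : V → ℝ} :
    x ∈ adjEigenspace G lam ↔
      ∀ v, ∑ u, (if G.Adj v u then x u else 0) = lam * x v := by
  have h (v : V) : (adjM G).mulVec x v = ∑ u, (if G.Adj v u then x u else 0) := by
    simp [Matrix.mulVec, dotProduct, adjM]
  simp only [adjEigenspace, LinearMap.mem_ker, Matrix.toLin'_apply, Matrix.sub_mulVec,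
    Matrix.smul_mulVec, Matrix.one_mulVec, funext_iff, Pi.smul_apply, smul_eq_mul, sub_eq_zero, h]

/-- In a tree, the neighbor of `v` one step closer to the root `r` is unique. -/
theorem SimpleGraph.IsTree.eq_of_adj_of_dist_add_one {V : Type*} {G : SimpleGraph V}
    (hG : G.IsTree) {r v a b : V} (ha : G.Adj v a) (hb : G.Adj v b)
    (hda : G.dist r v = G.dist r a + 1) (hdb : G.dist r v = G.dist r b + 1) : a = b := by
  obtain ⟨p, hp⟩ := hG.connected.exists_walk_length_eq_dist r a
  obtain ⟨q, hq⟩ := hG.connected.exists_walk_length_eq_dist r b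
  have hp' : (p.concat ha.symm).IsPath :=
    SimpleGraph.Walk.isPath_of_length_eq_dist _ (by simp [hp, hda])
  have hq' : (q.concat hb.symm).IsPath :=
    SimpleGraph.Walk.isPath_of_length_eq_dist _ (by simp [hq, hdb])
  have h := (hG.existsUnique_path r v).unique hp' hq'
  simpa using congrArg SimpleGraph.Walk.penultimate h

theorem SimpleGraph.Connected.deg_pos {V : Type*} [Finite V] [Nontrivial V] {G : SimpleGraph V}
    (hG : G.Connected) (v : V) : 0 < deg G v := by
  obtain ⟨u, hu⟩ := hG.preconnected.exists_adj_of_nontrivial v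
  exact (Set.ncard_pos (Set.toFinite _)).2 ⟨u, hu⟩

/-- In a tree, a vertex that is the root or not pendant has a neighbor one step further from the
root. -/
theorem SimpleGraph.IsTree.exists_adj_dist_eq_add_one {V : Type*} [Finite V] [Nontrivial V]
    {G : SimpleGraph V} (hG : G.IsTree) {r v : V} (hv : v = r ∨ deg G v ≠ 1) :
    ∃ c, G.Adj v c ∧ G.dist r c = G.dist r v + 1 := by
  have hpos := hG.connected.deg_pos v
  by_contra! hc
  have hpar (c : V) (h : G.Adj v c) : G.dist r v = G.dist r c + 1 := by
    have := hc c h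
    have := hG.dist_eq_dist_add_one_of_adj r h
    omega
  obtain ⟨a, ha⟩ := (Set.ncard_pos (Set.toFinite _)).1 hpos
  rcases hv with rfl | hv
  · simpa using hpar a ha
  · have h1 : 1 < (G.neighborSet v).ncard := by
      unfold deg at hpos hv
      omega
    obtain ⟨a, b, ha, hb, hab⟩ := (Set.one_lt_ncard_iff (Set.toFinite _)).1 h1
    exact hab (hG.eq_of_adj_of_dist_add_one ha hb (hpar a ha) (hpar b hb))

/-- An eigenvector of a tree that vanishes at all pendant vertices except possibly the root is
zero. -/
theorem SimpleGraph.IsTree.eq_zero_of_eq_zero_on_pendant {V : Type*} [Fintype V] [Nontrivial V]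
    {G : SimpleGraph V} (hG : G.IsTree) (r : V) {lam : ℝ} {x : V → ℝ}
    (hx : ∀ v, ∑ u, (if G.Adj v u then x u else 0) = lam * x v)
    (hp : ∀ v, v ≠ r → deg G v = 1 → x v = 0) : x = 0 := by
  obtain ⟨N, hN⟩ : ∃ N, ∀ v, G.dist r v ≤ N :=
    ⟨Finset.univ.sup (G.dist r), fun v => Finset.le_sup (Finset.mem_univ v)⟩
  suffices h : ∀ n v, N + 1 ≤ G.dist r v + n → x v = 0 from
    funext fun v => h (N + 1) v (by omega)
  intro n
  induction n with
  | zero => intro v hv; have := hN v; omega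
  | succ n ih =>
    intro v hv
    by_cases h : v ≠ r ∧ deg G v = 1
    · exact hp v h.1 h.2
    · obtain ⟨c, hvc, hc⟩ := hG.exists_adj_dist_eq_add_one (r := r) (v := v) (by tauto)
      have hsum := hx c
      rw [ih c (by omega), mul_zero, Finset.sum_eq_single v] at hsum
      · simpa [hvc.symm] using hsum
      · intro u _ huv
        split_ifs with hcu
        · refine ih u ?_
          rcases hG.dist_eq_dist_add_one_of_adj r hcu with h' | h'
          · exact absurd (hG.eq_of_adj_of_dist_add_one hcu hvc.symm h' hc) huv
          · omega
        · rfl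
      · simp

theorem gMult_le_ncard_pendant_ne {V : Type*} [Fintype V] [Nontrivial V]
    {G : SimpleGraph V} (hG : G.IsTree) (r : V) (lam : ℝ) :
    gMult G lam ≤ {v | v ≠ r ∧ deg G v = 1}.ncard := by
  let f := (LinearMap.funLeft ℝ ℝ (Subtype.val : {v | v ≠ r ∧ deg G v = 1} → V)).domRestrict
    (adjEigenspace G lam)
  have hf : Function.Injective f := by
    rw [← LinearMap.ker_eq_bot, LinearMap.ker_eq_bot']
    rintro ⟨x, hx⟩ h
    rw [mem_adjEigenspace] at hx
    refine Subtype.ext (hG.eq_zero_of_eq_zero_on_pendant r hx fun v hv hd => ?_)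
    exact congrFun h ⟨v, hv, hd⟩
  refine (LinearMap.finrank_le_finrank_of_injective hf).trans ?_
  rw [Module.finrank_pi, ← Nat.card_coe_set_eq, Nat.card_eq_fintype_card]

theorem gMult_add_one_le_pendCount' {V : Type*} [Fintype V]
    {G : SimpleGraph V} (hG : G.IsTree) (lam : ℝ) :
    gMult G lam + 1 ≤ pendCount' G := by
  unfold pendCount'
  split_ifs with h
  · have h1 : gMult G lam ≤ Module.finrank ℝ (V → ℝ) := Submodule.finrank_le _
    rw [Module.finrank_pi, ← Nat.card_eq_fintype_card] at h1
    omega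
  · have : Nontrivial V := by
      rw [← Finite.one_lt_card_iff_nontrivial]
      omega
    obtain ⟨r, hr⟩ := hG.exists_vert_degree_one_of_nontrivial
    have hr' : r ∈ {v | deg G v = 1} := by
      rw [Set.mem_ofPred_eq, deg, ← hr, ← SimpleGraph.card_neighborSet_eq_degree,
        ← Nat.card_coe_set_eq, Nat.card_eq_fintype_card]
    have hle := gMult_le_ncard_pendant_ne hG r lam
    have hset : {v | v ≠ r ∧ deg G v = 1} = {v | deg G v = 1} \ {r} := by
      ext v
      simp [and_comm]
    rw [hset] at hle
    have := Set.ncard_sdiff_singleton_add_one hr' (Set.toFinite _)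
    unfold pendCount
    omega

section compSupp

variable {V : Type*} {T : SimpleGraph V} {w : V} {c : (T.induce {u | u ≠ w}).ConnectedComponent}

theorem mem_compSupp {v : V} :
    v ∈ compSupp T w c ↔ ∃ h : v ≠ w, (T.induce {u | u ≠ w}).connectedComponentMk ⟨v, h⟩ = c := by
  simp [compSupp]

theorem mem_compSupp_of_adj {v u : V} (hv : v ∈ compSupp T w c) (h : T.Adj v u) (hu : u ≠ w) :
    u ∈ compSupp T w c := by
  obtain ⟨hvw, rfl⟩ := mem_compSupp.1 hv
  refine mem_compSupp.2 ⟨hu, SimpleGraph.ConnectedComponent.sound ?_⟩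
  exact SimpleGraph.Adj.reachable (SimpleGraph.comap_adj.2 h.symm)

theorem SimpleGraph.IsTree.induce_compSupp (hT : T.IsTree)
    (c : (T.induce {u | u ≠ w}).ConnectedComponent) : (T.induce (compSupp T w c)).IsTree := by
  refine ⟨?_, hT.isAcyclic.induce _⟩
  let f : c.toSimpleGraph →g T.induce (compSupp T w c) :=
    { toFun := fun v => ⟨v.1.1, v.1, v.2, rfl⟩
      map_rel' := fun h => h }
  refine c.connected_toSimpleGraph.map f ?_
  rintro ⟨_, v, hv, rfl⟩
  exact ⟨⟨v, hv⟩, rfl⟩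

/-- Deleting `w` from an acyclic graph separates the neighbors of `w`. -/
theorem SimpleGraph.IsAcyclic.eq_of_adj_of_mem_compSupp (hT : T.IsAcyclic) {a b : V}
    (ha : a ∈ compSupp T w c) (hb : b ∈ compSupp T w c) (haw : T.Adj a w) (hbw : T.Adj b w) :
    a = b := by
  by_contra hab
  obtain ⟨ha', hac⟩ := mem_compSupp.1 ha
  obtain ⟨hb', hbc⟩ := mem_compSupp.1 hb
  have hr := SimpleGraph.ConnectedComponent.exact (hac.trans hbc.symm)
  have hbr := SimpleGraph.isBridge_iff.1 (SimpleGraph.isAcyclic_iff_forall_adj_isBridge.1 hT haw)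
  let f : T.induce {u | u ≠ w} →g T.deleteEdges {s(a, w)} :=
    { toFun := Subtype.val
      map_rel' := by
        rintro ⟨x, hx⟩ ⟨y, hy⟩ h
        simp only [Set.mem_ofPred_eq] at hx hy
        simp only [SimpleGraph.comap_adj, Function.Embedding.subtype_apply] at h
        simp [h, hx, hy] }
  have h1 : (T.deleteEdges {s(a, w)}).Reachable a b := hr.map f
  have h2 : (T.deleteEdges {s(a, w)}).Adj b w := by
    simp [hbw, Ne.symm hab, hb']
  exact hbr (h1.trans h2.reachable)

theorem deg_induce_compSupp (v : compSupp T w c) (h : ¬ T.Adj v w) :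
    deg (T.induce (compSupp T w c)) v = deg T v := by
  unfold deg
  rw [← Set.ncard_image_of_injective _ Subtype.val_injective]
  congr 1
  ext u
  simp only [Set.mem_image, SimpleGraph.mem_neighborSet, SimpleGraph.comap_adj,
    Function.Embedding.subtype_apply, Subtype.exists, exists_and_left, exists_prop,
    exists_eq_right_right]
  exact ⟨fun hu => hu.1, fun hu =>
    ⟨hu, mem_compSupp_of_adj v.2 hu fun huw => h (huw ▸ hu)⟩⟩

theorem pendCount'_induce_compSupp_le [Finite V] (hT : T.IsTree)
    (c : (T.induce {u | u ≠ w}).ConnectedComponent) :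
    pendCount' (T.induce (compSupp T w c)) ≤
      {v | v ∈ compSupp T w c ∧ deg T v = 1}.ncard + 1 := by
  unfold pendCount'
  split_ifs with h
  · obtain ⟨u, hu⟩ : (compSupp T w c).Nonempty := c.nonempty_supp.image _
    have huw : u ≠ w := (mem_compSupp.1 hu).1
    have : Nontrivial V := ⟨u, w, huw⟩
    have hsub := Finite.card_le_one_iff_subsingleton.1 h
    have hN : T.neighborSet u ⊆ {w} := by
      intro x hx
      by_contra hxw
      have := congrArg Subtype.val
        (hsub.elim ⟨x, mem_compSupp_of_adj hu hx hxw⟩ ⟨u, hu⟩)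
      exact (T.ne_of_adj hx) this.symm
    have h1 := Set.ncard_le_ncard hN
    have h2 := hT.connected.deg_pos u
    rw [Set.ncard_singleton] at h1
    have : 0 < {v | v ∈ compSupp T w c ∧ deg T v = 1}.ncard :=
      (Set.ncard_pos (Set.toFinite _)).2 ⟨u, hu, le_antisymm h1 h2⟩
    omega
  · unfold pendCount
    rw [← Set.ncard_image_of_injective _ Subtype.val_injective]
    by_cases hex : ∃ a ∈ compSupp T w c, T.Adj a w
    · obtain ⟨a, ha, haw⟩ := hex
      refine (Set.ncard_le_ncard ?_ (Set.toFinite _)).trans (Set.ncard_insert_le a _)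
      rintro _ ⟨v, hv, rfl⟩
      by_cases hvw : T.Adj v w
      · exact Or.inl (hT.isAcyclic.eq_of_adj_of_mem_compSupp v.2 ha hvw haw)
      · exact Or.inr ⟨v.2, (deg_induce_compSupp v hvw).symm.trans hv⟩
    · push Not at hex
      refine (Set.ncard_le_ncard ?_ (Set.toFinite _)).trans (Nat.le_succ _)
      rintro _ ⟨v, hv, rfl⟩
      exact ⟨v.2, (deg_induce_compSupp v (hex v v.2)).symm.trans hv⟩

theorem sum_ncard_pendant_compSupp_le [Finite V]
    [Fintype (T.induce {u | u ≠ w}).ConnectedComponent] :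
    ∑ c, {v | v ∈ compSupp T w c ∧ deg T v = 1}.ncard ≤ pendCount T := by
  simp_rw [pendCount, ← Nat.card_coe_set_eq]
  rw [← Nat.card_sigma]
  refine Nat.card_le_card_of_injective (fun x => ⟨x.2.1, x.2.2.2⟩) ?_
  rintro ⟨c, v, hv, hd⟩ ⟨c', v', hv', hd'⟩ h
  obtain rfl : v = v' := congrArg Subtype.val h
  obtain ⟨_, rfl⟩ := mem_compSupp.1 hv
  obtain ⟨_, rfl⟩ := mem_compSupp.1 hv'
  rfl

theorem sMult_ne_le_sum_sMult_compSupp [Fintype V]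
    [Fintype (T.induce {u | u ≠ w}).ConnectedComponent] (lam : ℝ) :
    sMult T {u | u ≠ w} lam ≤ ∑ c, sMult T (compSupp T w c) lam := by
  let emb (c) (v : compSupp T w c) : {u | u ≠ w} := ⟨v.1, (mem_compSupp.1 v.2).1⟩
  let K := adjEigenspace (T.induce {u | u ≠ w}) lam
  let K' (c) := adjEigenspace (T.induce (compSupp T w c)) lam
  have hK (c) (x : K) : LinearMap.funLeft ℝ ℝ (emb c) x ∈ K' c := by
    obtain ⟨x, hx⟩ := x
    rw [mem_adjEigenspace] at hx ⊢
    intro v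
    rw [LinearMap.funLeft_apply, ← hx (emb c v)]
    have hinj : Function.Injective (emb c) := fun a b h =>
      Subtype.ext (congrArg (fun u => u.1) h)
    refine Fintype.sum_of_injective (emb c) hinj _ _ ?_ fun u => rfl
    intro u hu
    refine if_neg fun h => hu ⟨⟨u.1, mem_compSupp_of_adj v.2 h u.2⟩, rfl⟩
  let f : K →ₗ[ℝ] ((c : (T.induce {u | u ≠ w}).ConnectedComponent) → K' c) :=
    LinearMap.pi fun c =>
      ((LinearMap.funLeft ℝ ℝ (emb c)).comp K.subtype).codRestrict (K' c) (hK c)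
  have hf : Function.Injective f := by
    rw [← LinearMap.ker_eq_bot, LinearMap.ker_eq_bot']
    intro x h
    ext v
    have hv : v.1 ∈ compSupp T w ((T.induce {u | u ≠ w}).connectedComponentMk v) :=
      mem_compSupp.2 ⟨v.2, rfl⟩
    exact congrFun (congrArg Subtype.val (congrFun h _)) ⟨v.1, hv⟩
  have h := LinearMap.finrank_le_finrank_of_injective hf
  rw [Module.finrank_pi_fintype] at h
  simp only [sMult_eq_gMult_induce]
  exact h

end compSupp

/-- Claim 3: if one component of `T - w` has `m = p - 2`, all others have
`m = p - 1`. -/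
theorem stmt16 {V : Type*} [Fintype V] (T : SimpleGraph V) (hT : T.IsTree)
    (lam : ℝ) (hp : 4 ≤ pendCount T) (hm : gMult T lam + 2 = pendCount T)
    (w : V) (hw : 3 ≤ deg T w)
    (hdel : sMult T {u | u ≠ w} lam + 1 = pendCount T)
    (ck : (T.induce {u | u ≠ w}).ConnectedComponent)
    (hk : sMult T (compSupp T w ck) lam + 2 =
      pendCount' (T.induce (compSupp T w ck))) :
    ∀ c ≠ ck, sMult T (compSupp T w c) lam + 1 =
      pendCount' (T.induce (compSupp T w c)) := by
  have : Fintype (T.induce {u | u ≠ w}).ConnectedComponent := Fintype.ofFinite _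
  have hlow (c : (T.induce {u | u ≠ w}).ConnectedComponent) :=
    gMult_add_one_le_pendCount' (hT.induce_compSupp c) lam
  have hup (c : (T.induce {u | u ≠ w}).ConnectedComponent) := pendCount'_induce_compSupp_le hT c
  have hsum := sMult_ne_le_sum_sMult_compSupp (T := T) (w := w) lam
  have hleaf := sum_ncard_pendant_compSupp_le (T := T) (w := w)
  intro c hc
  by_contra hne
  change ∀ c, sMult T (compSupp T w c) lam + 1 ≤ _ at hlow
  have key : ∑ d, (sMult T (compSupp T w d) lam + (if d = ck then 1 else 0) +
      (if d = c then 1 else 0)) ≤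
      ∑ d, {v | v ∈ compSupp T w d ∧ deg T v = 1}.ncard := by
    refine Finset.sum_le_sum fun d _ => ?_
    have h1 := hlow d
    have h2 := hup d
    split_ifs with hd hd' hd'
    · exact absurd (hd'.symm.trans hd) hc
    · subst hd; omega
    · subst hd'; omega
    · omega
  simp only [Finset.sum_add_distrib, Finset.sum_ite_eq', Finset.mem_univ, if_true] at key
  omega
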